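/- Suppose both the decision maker's utility u and the insurer's utility v are linear and the no-sabotage condition is imposed (feasible set 𝓘̂). Suppose the worst-case prior P and the insurer's prior Q are such that the distributions F_{X,P} and F_{X,Q} of the loss X are continuous on [0,M], admit densities f_{X,P} and f_{X,Q} with f_{X,P}/f_{X,Q} nondecreasing, and F_{X,Q} is continuous. Then there exist 0 ≤ d₁ ≤ d₂ ≤ M such that an optimal marginal retention satisfies (r̂*)'(t) = 1 for 0 ≤ t < d₁, (r̂*)'(t) = κ(t) ∈ [0,1] for d₁ ≤ t ≤ d₂, and (r̂*)'(t) = 0 for t > d₂; in particular, choosing κ ≡ 0, the deductible indemnity Ŷ* = max(X − d, 0) with d = d₁ is optimal, and if F_{X,Q} is strictly increasing then d₁ = d₂. -/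

import Mathlib

open MeasureTheory

/-- A function `Y : S → ℝ` is a no-sabotage indemnity for the loss `X : S → [0,M]`:
`Y = Î ∘ X` with `Î 0 = 0` and `0 ≤ Î x₁ − Î x₂ ≤ x₁ − x₂` for `0 ≤ x₂ ≤ x₁ ≤ M`. -/
def NoSabotage {S : Type*} (M : ℝ) (X : S → ℝ) (Y : S → ℝ) : Prop :=
  ∃ I : ℝ → ℝ, I 0 = 0 ∧
    (∀ x₁ x₂ : ℝ, 0 ≤ x₂ → x₂ ≤ x₁ → x₁ ≤ M → 0 ≤ I x₁ - I x₂ ∧ I x₁ - I x₂ ≤ x₁ - x₂) ∧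
    ∀ s, Y s = I (X s)

/-- With linear utilities, an indemnity `Y` is optimal if it is a feasible no-sabotage
indemnity (budget `(1+ρ)E_Q[Y] ≤ π₀`) minimizing the expected retention `E_P[X − Y]`
over all feasible no-sabotage indemnities. -/
def IsOptimalLinear {S : Type*} [MeasurableSpace S] (M : ℝ) (X : S → ℝ)
    (P Q : Measure S) (π₀ ρ : ℝ) (Y : S → ℝ) : Prop :=
  NoSabotage M X Y ∧ (1 + ρ) * (∫ s, Y s ∂Q) ≤ π₀ ∧
    ∀ Y' : S → ℝ, NoSabotage M X Y' → (1 + ρ) * (∫ s, Y' s ∂Q) ≤ π₀ →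
      (∫ s, (X s - Y s) ∂P) ≤ ∫ s, (X s - Y' s) ∂P

/-- If `P ≤ l Q` where `h < 0` and `l Q ≤ P` where `h > 0`, then `l ∫ h dQ ≤ ∫ h dP`. -/
lemma mul_integral_le_integral_of_restrict_le {α : Type*} [MeasurableSpace α]
    {P Q : Measure α} {h : α → ℝ} {l : NNReal} (hm : Measurable h)
    (hP : Integrable h P) (hQ : Integrable h Q)
    (hneg : P.restrict {x | h x < 0} ≤ l • Q.restrict {x | h x < 0})
    (hpos : l • Q.restrict {x | 0 < h x} ≤ P.restrict {x | 0 < h x}) :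
    l * ∫ x, h x ∂Q ≤ ∫ x, h x ∂P := by
  have hA : MeasurableSet {x | h x < 0} := measurableSet_lt hm measurable_const
  have hB : MeasurableSet {x | 0 < h x} := measurableSet_lt measurable_const hm
  have split : ∀ μ : Measure α, Integrable h μ →
      ∫ x, h x ∂μ = ∫ x in {x | 0 < h x}, h x ∂μ - ∫ x in {x | h x < 0}, -h x ∂μ := by
    intro μ hμ
    rw [integral_neg, sub_neg_eq_add, ← integral_indicator hA, ← integral_indicator hB,
      ← integral_add (hμ.indicator hB) (hμ.indicator hA)]
    congr 1 with x
    rcases lt_trichotomy (h x) 0 with hx | hx | hx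
    · simp [Set.indicator, hx, not_lt.2 hx.le]
    · simp [Set.indicator, hx]
    · simp [Set.indicator, hx, not_lt.2 hx.le]
  have h1 : ∫ x in {x | h x < 0}, -h x ∂P ≤ l * ∫ x in {x | h x < 0}, -h x ∂Q := by
    have hint : Integrable (fun x => -h x) (l • Q.restrict {x | h x < 0}) :=
      hQ.neg.restrict.smul_measure_nnreal
    have := integral_mono_measure hneg (Measure.ae_smul_measure
      ((ae_restrict_iff' hA).2 (ae_of_all _ fun x (hx : h x < 0) =>
        (neg_nonneg.2 hx.le : (0 : ℝ) ≤ -h x))) l) hint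
    rwa [integral_smul_nnreal_measure, NNReal.smul_def, smul_eq_mul] at this
  have h2 : l * ∫ x in {x | 0 < h x}, h x ∂Q ≤ ∫ x in {x | 0 < h x}, h x ∂P := by
    have := integral_mono_measure hpos
      ((ae_restrict_iff' hB).2 (ae_of_all _ fun x (hx : 0 < h x) => (hx.le : (0 : ℝ) ≤ h x)))
      hP.restrict
    rwa [integral_smul_nnreal_measure, NNReal.smul_def, smul_eq_mul] at this
  rw [split P hP, split Q hQ, mul_sub]
  linarith

/-- A density is positive almost everywhere for the measure it defines, even when it is not
measurable. -/
lemma ae_withDensity_ne_zero {α : Type*} [MeasurableSpace α] (μ : Measure α) [SFinite μ]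
    (f : α → ENNReal) : ∀ᵐ x ∂μ.withDensity f, f x ≠ 0 := by
  obtain ⟨g, hg, hgf, heq⟩ := exists_measurable_le_withDensity_eq μ f
  rw [← heq]
  filter_upwards [(ae_withDensity_iff hg).2 (ae_of_all μ fun x (hx : g x ≠ 0) => hx)] with x hx h0
  exact hx (le_antisymm (h0 ▸ hgf x) zero_le)

/-- Comparison of two measures on a measurable set from a comparison of densities. -/
lemma restrict_withDensity_le_smul {α : Type*} [MeasurableSpace α] {μ : Measure α}
    {f g : α → ℝ} {s : Set α} {k l : NNReal} (hs : MeasurableSet s)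
    (hfg : ∀ᵐ x ∂μ, x ∈ s → k * f x ≤ l * g x) :
    k • (μ.withDensity fun x => ENNReal.ofReal (f x)).restrict s ≤
      l • (μ.withDensity fun x => ENNReal.ofReal (g x)).restrict s := by
  have smul_eq : ∀ (c : NNReal) (u : α → ℝ),
      c • (μ.withDensity fun x => ENNReal.ofReal (u x)).restrict s =
        (μ.restrict s).withDensity fun x => ENNReal.ofReal (c * u x) := by
    intro c u
    rw [restrict_withDensity hs]
    have := withDensity_smul' (μ := μ.restrict s) (c : ENNReal) (fun x => ENNReal.ofReal (u x))
      ENNReal.coe_ne_top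
    rw [show c • (μ.restrict s).withDensity (fun x => ENNReal.ofReal (u x)) =
      (c : ENNReal) • (μ.restrict s).withDensity (fun x => ENNReal.ofReal (u x)) from rfl, ← this]
    congr 1 with x
    simp [ENNReal.ofReal_mul]
  rw [smul_eq, smul_eq]
  apply withDensity_mono
  filter_upwards [(ae_restrict_iff' hs).2 hfg] with x hx
  exact ENNReal.ofReal_le_ofReal hx

/-- A no-sabotage indemnity factors through the loss by an indemnity function that is monotone
and nonexpansive on all of `ℝ`. -/
lemma NoSabotage.exists_extension {S : Type*} {M : ℝ} (hM : 0 ≤ M) {X Y : S → ℝ}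
    (hX : ∀ s, X s ∈ Set.Icc (0 : ℝ) M) (hY : NoSabotage M X Y) :
    ∃ J : ℝ → ℝ, J 0 = 0 ∧ Continuous J ∧ Monotone J ∧ Monotone (fun x => x - J x) ∧
      ∀ s, Y s = J (X s) := by
  obtain ⟨I, hI0, hI, hYI⟩ := hY
  have hproj : ∀ x, max 0 (min x M) ∈ Set.Icc 0 M := fun x =>
    ⟨le_max_left _ _, max_le hM (min_le_right _ _)⟩
  have hpm : Monotone fun x : ℝ => max 0 (min x M) := fun x y hxy =>
    max_le_max_left _ (min_le_min_right _ hxy)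
  have hmono : Monotone fun x => I (max 0 (min x M)) := fun x y hxy =>
    sub_nonneg.1 (hI _ _ (hproj x).1 (hpm hxy) (hproj y).2).1
  have hmono' : Monotone fun x => x - I (max 0 (min x M)) := fun x y hxy => by
    have h1 := (hI _ _ (hproj x).1 (hpm hxy) (hproj y).2).2
    have h2 : max 0 (min y M) - max 0 (min x M) ≤ y - x := by grind
    dsimp only
    linarith
  refine ⟨fun x => I (max 0 (min x M)), by simp [hM, hI0], ?_, hmono, hmono', fun s => ?_⟩
  · refine (LipschitzWith.of_dist_le_mul (K := 1) fun x y => ?_).continuous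
    rw [Real.dist_eq, Real.dist_eq, NNReal.coe_one, one_mul]
    rcases le_total x y with hxy | hxy
    · have h1 := hmono hxy
      have h2 := hmono' hxy
      dsimp only at h1 h2
      rw [abs_of_nonpos (by linarith), abs_of_nonpos (by linarith)]
      linarith
    · have h1 := hmono hxy
      have h2 := hmono' hxy
      dsimp only at h1 h2
      rw [abs_of_nonneg (by linarith), abs_of_nonneg (by linarith)]
      linarith
  · simp [hYI, (hX s).1, (hX s).2]

lemma integrable_comp_of_mem_Icc {S : Type*} [MeasurableSpace S] {M : ℝ} {X : S → ℝ}
    (hXm : Measurable X) (hX : ∀ s, X s ∈ Set.Icc (0 : ℝ) M) (μ : Measure S) [IsFiniteMeasure μ]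
    {f : ℝ → ℝ} (hf : Continuous f) : Integrable (fun s => f (X s)) μ := by
  obtain ⟨C, hC⟩ := isCompact_Icc.exists_bound_of_continuousOn (hf.continuousOn (s := Set.Icc 0 M))
  exact Integrable.of_bound (hf.measurable.comp hXm).aestronglyMeasurable C
    (ae_of_all _ fun s => hC _ (hX s))

/-- Some deductible exhausts the premium budget. -/
lemma exists_deductible_integral_eq {S : Type*} [MeasurableSpace S] {M : ℝ} (hM : 0 ≤ M)
    {X : S → ℝ} (hXm : Measurable X) (hX : ∀ s, X s ∈ Set.Icc (0 : ℝ) M)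
    (Q : Measure S) [IsFiniteMeasure Q] {b : ℝ} (hb : 0 ≤ b) (hbX : b ≤ ∫ s, X s ∂Q) :
    ∃ d ∈ Set.Icc 0 M, ∫ s, max (X s - d) 0 ∂Q = b := by
  have hcont : ContinuousOn (fun d => ∫ s, max (X s - d) 0 ∂Q) (Set.Icc 0 M) := by
    refine continuousOn_of_dominated (bound := fun _ => M) (fun d _ => ?_) (fun d hd => ?_)
      (integrable_const M) ?_
    · fun_prop
    · refine ae_of_all _ fun s => ?_
      rw [Real.norm_of_nonneg (le_max_right _ _)]
      exact max_le (by linarith [hd.1, (hX s).2]) hM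
    · exact ae_of_all _ fun s => by fun_prop
  have h0 : ∫ s, max (X s - 0) 0 ∂Q = ∫ s, X s ∂Q :=
    integral_congr_ae (ae_of_all _ fun s => by simp [(hX s).1])
  have hMz : ∫ s, max (X s - M) 0 ∂Q = 0 :=
    integral_eq_zero_of_ae (ae_of_all _ fun s => by simp [(hX s).2])
  obtain ⟨d, hd, hdb⟩ := intermediate_value_Icc' hM hcont
    (show b ∈ Set.Icc _ _ by rw [h0, hMz]; exact ⟨hb, hbX⟩)
  exact ⟨d, hd, hdb⟩

lemma noSabotage_deductible {S : Type*} (M : ℝ) (X : S → ℝ) {d : ℝ} (hd : 0 ≤ d) :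
    NoSabotage M X fun s => max (X s - d) 0 :=
  ⟨fun x => max (x - d) 0, by simp [hd], fun x y _ _ _ => by grind, fun _ => rfl⟩

lemma integral_indicator_Iic_one {d x : ℝ} (hd : 0 ≤ d) (hx : 0 ≤ x) :
    ∫ t in (0 : ℝ)..x, (Set.Iic d).indicator (fun _ => (1 : ℝ)) t = min x d := by
  rw [intervalIntegral.integral_of_le hx, setIntegral_indicator measurableSet_Iic,
    Set.Ioc_inter_Iic]
  simp [hx, hd]

/-- Under a monotone likelihood ratio, a deductible with positive expected payment is preferred
under `P` to every no-sabotage indemnity that is not more expensive under `Q`. -/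
lemma NoSabotage.integral_le_integral_deductible {S : Type*} [MeasurableSpace S] {M : ℝ}
    (hM : 0 ≤ M) {X : S → ℝ} (hXm : Measurable X) (hX : ∀ s, X s ∈ Set.Icc (0 : ℝ) M)
    {P Q : Measure S} [IsFiniteMeasure P] [IsFiniteMeasure Q]
    {fP fQ : ℝ → ℝ} (hfP0 : ∀ x, 0 ≤ fP x) (hfQ0 : ∀ x, 0 ≤ fQ x)
    (hPd : P.map X = ((volume : Measure ℝ).restrict (Set.Icc (0 : ℝ) M)).withDensity
      (fun x => ENNReal.ofReal (fP x)))
    (hQd : Q.map X = ((volume : Measure ℝ).restrict (Set.Icc (0 : ℝ) M)).withDensity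
      (fun x => ENNReal.ofReal (fQ x)))
    (hlr : ∀ x ∈ Set.Icc (0 : ℝ) M, ∀ y ∈ Set.Icc (0 : ℝ) M, x ≤ y →
      fP x * fQ y ≤ fP y * fQ x)
    {d : ℝ} (hpos : 0 < ∫ s, max (X s - d) 0 ∂Q)
    {Y : S → ℝ} (hY : NoSabotage M X Y) (hYQ : ∫ s, Y s ∂Q ≤ ∫ s, max (X s - d) 0 ∂Q) :
    ∫ s, Y s ∂P ≤ ∫ s, max (X s - d) 0 ∂P := by
  obtain ⟨J, hJ0, hJc, hJm, hJm', hYJ⟩ := hY.exists_extension hM hX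
  simp only [hYJ] at hYQ ⊢
  have hdc : Continuous fun x : ℝ => max (x - d) 0 := by fun_prop
  have hhc : Continuous fun x => max (x - d) 0 - J x := hdc.sub hJc
  set h : ℝ → ℝ := fun x => max (x - d) 0 - J x with h_def
  have hle : ∀ x, 0 ≤ x → x ≤ d → h x ≤ 0 := fun x hx0 hxd => by
    have := hJm hx0
    simp only [h_def, max_eq_right (sub_nonpos.2 hxd)]
    linarith
  have hmono : ∀ x y, d < x → h x < h y → d < y → x < y := fun x y hdx hxy hdy => by
    by_contra! hyx
    have := hJm' hyx
    simp only [h_def, max_eq_left (sub_pos.2 hdx).le, max_eq_left (sub_pos.2 hdy).le] at hxy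
    dsimp only at this
    linarith
  have hint : ∀ (μ : Measure S) [IsFiniteMeasure μ],
      ∫ s, h (X s) ∂μ = ∫ s, max (X s - d) 0 ∂μ - ∫ s, J (X s) ∂μ := fun μ _ =>
    integral_sub (integrable_comp_of_mem_Icc hXm hX μ hdc)
      (integrable_comp_of_mem_Icc hXm hX μ hJc)
  have hQ0 : 0 ≤ ∫ s, h (X s) ∂Q := by rw [hint]; linarith
  suffices 0 ≤ ∫ s, h (X s) ∂P by rw [hint] at this; linarith
  let B : Set ℝ := {y | y ∈ Set.Icc 0 M ∧ d < y ∧ 0 < fQ y ∧ 0 ≤ h y}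
  have hB : B.Nonempty := by
    by_contra! hBe
    have hfpos : ∀ᵐ s ∂Q, ENNReal.ofReal (fQ (X s)) ≠ 0 := by
      apply ae_of_ae_map hXm.aemeasurable (p := fun x => ENNReal.ofReal (fQ x) ≠ 0)
      rw [hQd]
      exact ae_withDensity_ne_zero _ _
    have hneg : ∀ᵐ s ∂Q, d < X s → h (X s) < 0 := by
      filter_upwards [hfpos] with s hs hds
      by_contra! hh
      have : X s ∈ B := ⟨hX s, hds, ENNReal.ofReal_pos.1 (pos_iff_ne_zero.2 hs), hh⟩
      rw [hBe] at this
      exact this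
    have hnonpos : 0 ≤ᵐ[Q] fun s => -h (X s) := by
      filter_upwards [hneg] with s hs
      rcases lt_or_ge d (X s) with hd | hd
      · exact neg_nonneg.2 (hs hd).le
      · exact neg_nonneg.2 (hle _ (hX s).1 hd)
    have hzero : (fun s => -h (X s)) =ᵐ[Q] 0 := by
      rw [← integral_eq_zero_iff_of_nonneg_ae hnonpos
        (integrable_comp_of_mem_Icc hXm hX Q hhc).neg]
      have := integral_nonneg_of_ae hnonpos
      rw [integral_neg] at this ⊢
      linarith
    refine hpos.ne' (integral_eq_zero_of_ae ?_)
    filter_upwards [hneg, hzero] with s hs hz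
    have hz' : h (X s) = 0 := neg_eq_zero.1 hz
    exact max_eq_right (sub_nonpos.2 (not_lt.1 fun hd => (hs hd).ne hz'))
  let l : ℝ := sInf ((fun y => fP y / fQ y) '' B)
  have hnn : ∀ r ∈ (fun y => fP y / fQ y) '' B, 0 ≤ r := by
    rintro _ ⟨y, -, rfl⟩
    exact div_nonneg (hfP0 y) (hfQ0 y)
  have hl0 : 0 ≤ l := Real.sInf_nonneg hnn
  have hnegP : ∀ x ∈ Set.Icc 0 M, h x < 0 → fP x ≤ l * fQ x := by
    intro x hx hhx
    have key : ∀ y ∈ B, fP x ≤ fP y / fQ y * fQ x := by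
      rintro y ⟨hy, hdy, hfy, hhy⟩
      have hxy : x ≤ y := by
        rcases lt_or_ge d x with hdx | hdx
        · exact (hmono x y hdx (hhx.trans_le hhy) hdy).le
        · exact hdx.trans hdy.le
      rw [div_mul_eq_mul_div, le_div_iff₀ hfy]
      exact hlr x hx y hy hxy
    rcases (hfQ0 x).eq_or_lt with h0 | h0
    · obtain ⟨y, hy⟩ := hB
      simpa [← h0] using key y hy
    · rw [← div_le_iff₀ h0]
      refine le_csInf (hB.image _) ?_
      rintro _ ⟨y, hy, rfl⟩
      exact (div_le_iff₀ h0).2 (key y hy)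
  have hposP : ∀ x ∈ Set.Icc 0 M, 0 < h x → l * fQ x ≤ fP x := by
    intro x hx hhx
    rcases (hfQ0 x).eq_or_lt with h0 | h0
    · simpa [← h0] using hfP0 x
    · rw [← le_div_iff₀ h0]
      refine csInf_le ⟨0, hnn⟩ ⟨x, ⟨hx, ?_, h0, hhx.le⟩, rfl⟩
      by_contra! hxd
      exact (hle x hx.1 hxd).not_gt hhx
  have hmap : ∀ μ : Measure S, ∫ s, h (X s) ∂μ = ∫ x, h x ∂μ.map X := fun μ =>
    (integral_map hXm.aemeasurable hhc.aestronglyMeasurable).symm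
  have hmi : ∀ (μ : Measure S) [IsFiniteMeasure μ], Integrable h (μ.map X) := fun μ _ =>
    (integrable_map_measure hhc.aestronglyMeasurable hXm.aemeasurable).2
      (integrable_comp_of_mem_Icc hXm hX μ hhc)
  have main : (⟨l, hl0⟩ : NNReal) * ∫ x, h x ∂Q.map X ≤ ∫ x, h x ∂P.map X := by
    refine mul_integral_le_integral_of_restrict_le hhc.measurable (hmi P) (hmi Q) ?_ ?_
    · rw [hPd, hQd, ← one_smul NNReal (Measure.restrict (Measure.withDensity _ fun x =>
        ENNReal.ofReal (fP x)) _)]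
      refine restrict_withDensity_le_smul (measurableSet_lt hhc.measurable measurable_const) ?_
      filter_upwards [ae_restrict_mem measurableSet_Icc] with x hx hhx
      rw [NNReal.coe_one, one_mul]
      exact hnegP x hx hhx
    · rw [hPd, hQd, ← one_smul NNReal (Measure.restrict (Measure.withDensity _ fun x =>
        ENNReal.ofReal (fP x)) _)]
      refine restrict_withDensity_le_smul (measurableSet_lt measurable_const hhc.measurable) ?_
      filter_upwards [ae_restrict_mem measurableSet_Icc] with x hx hhx
      rw [NNReal.coe_one, one_mul]
      exact hposP x hx hhx
  rw [← hmap, ← hmap] at main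
  exact (mul_nonneg hl0 hQ0).trans main

/-- Examples 4.4/4.5: with linear utilities for both agents, the no-sabotage condition,
and distributions `F_{X,P}, F_{X,Q}` of the loss admitting Lebesgue densities
`f_P, f_Q` on `[0,M]` with nondecreasing likelihood ratio `f_P/f_Q` and continuous
`F_{X,Q}`, there exist `0 ≤ d₁ ≤ d₂ ≤ M` such that an optimal marginal retention is
`1` below `d₁`, some `κ(t) ∈ [0,1]` on `[d₁,d₂]` and `0` above `d₂`; in particular the
deductible indemnity `max(X − d₁, 0)` is optimal, and if `F_{X,Q}` is strictly
increasing then `d₁ = d₂`. -/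
theorem deductible_optimal_linear_utilities {S : Type*} [MeasurableSpace S]
    (M : ℝ) (hM : 0 < M)
    (X : S → ℝ) (hXm : Measurable X) (hX : ∀ s, X s ∈ Set.Icc (0:ℝ) M)
    (Q P : Measure S) [IsProbabilityMeasure Q] [IsProbabilityMeasure P]
    (fP fQ : ℝ → ℝ) (hfP0 : ∀ x, 0 ≤ fP x) (hfQ0 : ∀ x, 0 ≤ fQ x)
    (hPd : P.map X = ((volume : Measure ℝ).restrict (Set.Icc (0:ℝ) M)).withDensity
      (fun x => ENNReal.ofReal (fP x)))
    (hQd : Q.map X = ((volume : Measure ℝ).restrict (Set.Icc (0:ℝ) M)).withDensity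
      (fun x => ENNReal.ofReal (fQ x)))
    (hlr : ∀ x ∈ Set.Icc (0:ℝ) M, ∀ y ∈ Set.Icc (0:ℝ) M, x ≤ y →
      fP x * fQ y ≤ fP y * fQ x)
    (hFQc : Continuous fun t : ℝ => ((Q.map X) (Set.Iic t)).toReal)
    (π₀ ρ : ℝ) (hπ : 0 < π₀) (hρ : 0 ≤ ρ)
    (hbudget : π₀ < (1 + ρ) * ∫ s, X s ∂Q) :
    ∃ d₁ ∈ Set.Icc (0:ℝ) M, ∃ d₂ ∈ Set.Icc (0:ℝ) M, d₁ ≤ d₂ ∧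
      (∃ g κ : ℝ → ℝ, (∀ t, κ t ∈ Set.Icc (0:ℝ) 1) ∧
        (∀ t, 0 ≤ t → t < d₁ → g t = 1) ∧
        (∀ t ∈ Set.Icc d₁ d₂, g t = κ t) ∧
        (∀ t, d₂ < t → t ≤ M → g t = 0) ∧
        IsOptimalLinear M X P Q π₀ ρ (fun s => X s - ∫ t in (0:ℝ)..(X s), g t)) ∧
      IsOptimalLinear M X P Q π₀ ρ (fun s => max (X s - d₁) 0) ∧
      (StrictMonoOn (fun t : ℝ => ((Q.map X) (Set.Iic t)).toReal) (Set.Icc (0:ℝ) M) →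
        d₁ = d₂) := by
  have hρ1 : 0 < 1 + ρ := by linarith
  obtain ⟨d, hd, hdb⟩ := exists_deductible_integral_eq hM.le hXm hX Q (b := π₀ / (1 + ρ))
    (div_pos hπ hρ1).le ((div_le_iff₀' hρ1).2 hbudget.le)
  have hbind : (1 + ρ) * ∫ s, max (X s - d) 0 ∂Q = π₀ := by
    rw [hdb, mul_div_cancel₀ _ hρ1.ne']
  have hXP : Integrable X P := integrable_comp_of_mem_Icc hXm hX P continuous_id
  have hopt : IsOptimalLinear M X P Q π₀ ρ fun s => max (X s - d) 0 := by
    refine ⟨noSabotage_deductible M X hd.1, hbind.le, fun Y hY hYb => ?_⟩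
    have hle := hY.integral_le_integral_deductible hM.le hXm hX hfP0 hfQ0 hPd hQd hlr
      (hdb ▸ div_pos hπ hρ1) (le_of_mul_le_mul_left (hYb.trans hbind.ge) hρ1)
    obtain ⟨J, -, hJc, -, -, hYJ⟩ := hY.exists_extension hM.le hX
    have hYi : Integrable Y P := by
      rw [funext hYJ]
      exact integrable_comp_of_mem_Icc hXm hX P hJc
    rw [integral_sub hXP hYi, integral_sub hXP
      (integrable_comp_of_mem_Icc hXm hX P (f := fun x => max (x - d) 0) (by fun_prop))]
    linarith
  refine ⟨d, hd, d, hd, le_rfl, ⟨(Set.Iic d).indicator fun _ => 1, fun _ => 1, by simp,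
    fun t _ ht => by simp [ht.le], fun t ht => by simp [ht.2], fun t ht _ => by simp [ht], ?_⟩,
    hopt, fun _ => rfl⟩
  convert hopt using 2 with s
  rw [integral_indicator_Iic_one hd.1 (hX s).1]
  grind
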